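/- For every finite graph G and every finite family of colorings C_1, …, C_m of V(G), every row of the reduced game structure of G with respect to C_1, …, C_m is nonempty; in particular, the reduced game structure has the same number of rows as the game structure. -/

import Mathlib

/-- The closed neighborhood `N[S]` of a set `S` of vertices. -/
def closedNbhd {V : Type*} (G : SimpleGraph V) (S : Set V) : Set V :=
  {v | v ∈ S ∨ ∃ s ∈ S, G.Adj s v}

/-- `appearsBy G C i S`: the set `S` appears in one of the rows `1, …, i` of the game
structure of `G` with respect to the family of colorings `C`.  Row 1 consists of all
singletons, and a nonempty set appears by row `i + 2` if it appears by row `i + 1`, or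
there is a coloring `C j` all of whose color classes on `N[S]` appear by row `i + 1`. -/
def appearsBy {V : Type*} {ι : Type*} {α : ι → Type*} (G : SimpleGraph V)
    (C : ∀ i : ι, V → α i) : ℕ → Set V → Prop
  | 0, _ => False
  | 1, S => ∃ v, S = {v}
  | i + 2, S => appearsBy G C (i + 1) S ∨
      (S.Nonempty ∧ ∃ j : ι, ∀ v ∈ closedNbhd G S,
        appearsBy G C (i + 1) {u ∈ closedNbhd G S | C j u = C j v})

/-- `S` lies in row `i` of the game structure: it appears by row `i` but not earlier. -/
def inRow {V : Type*} {ι : Type*} {α : ι → Type*} (G : SimpleGraph V)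
    (C : ∀ i : ι, V → α i) (i : ℕ) (S : Set V) : Prop :=
  appearsBy G C i S ∧ ¬ appearsBy G C (i - 1) S

/-- The number of rows of the game structure: the largest `i` whose row is nonempty. -/
noncomputable def numRows {V : Type*} {ι : Type*} {α : ι → Type*} (G : SimpleGraph V)
    (C : ∀ i : ι, V → α i) : ℕ :=
  sSup {i | ∃ S : Set V, inRow G C i S}

/-- The coloring `C j` is adjoined to a set `S` lying in row `i`: every color class of
`C j` restricted to `N[S]` appears in rows `1, …, i − 1`. -/
def adjoinedAt {V : Type*} {ι : Type*} {α : ι → Type*} (G : SimpleGraph V)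
    (C : ∀ i : ι, V → α i) (i : ℕ) (S : Set V) (j : ι) : Prop :=
  ∀ v ∈ closedNbhd G S, appearsBy G C (i - 1) {u ∈ closedNbhd G S | C j u = C j v}

/-- `P` (lying in row `i + 1`) is a parent of `T` (lying in row `i`): `T` is
monochromatic in some coloring adjoined to `P`. -/
def isParentOf {V : Type*} {ι : Type*} {α : ι → Type*} (G : SimpleGraph V)
    (C : ∀ i : ι, V → α i) (i : ℕ) (P T : Set V) : Prop :=
  inRow G C (i + 1) P ∧ inRow G C i T ∧
    ∃ j : ι, adjoinedAt G C (i + 1) P j ∧ ∀ x ∈ T, ∀ y ∈ T, C j x = C j y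

/-- `reducedAux G C R d` is the set of sets kept in row `R − d` of the reduced game
structure (where `R` is the number of rows), defined from the highest row down: in the
highest row `R` one keeps the sets all of whose nonempty proper subsets lie in lower
rows; in each subsequent lower row one keeps the sets all of whose nonempty proper
subsets lie in lower rows and that have a parent among the sets kept in the row above. -/
def reducedAux {V : Type*} {ι : Type*} {α : ι → Type*} (G : SimpleGraph V)
    (C : ∀ i : ι, V → α i) (R : ℕ) : ℕ → Set (Set V)
  | 0 => {S | inRow G C R S ∧ ∀ T : Set V, T ⊂ S → T.Nonempty → appearsBy G C (R - 1) T}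
  | d + 1 => {S | inRow G C (R - (d + 1)) S ∧
      (∀ T : Set V, T ⊂ S → T.Nonempty → appearsBy G C (R - (d + 1) - 1) T) ∧
      ∃ P ∈ reducedAux G C R d, isParentOf G C (R - (d + 1)) P S}

/-- Row `i` of the reduced game structure of `G` with respect to the colorings `C`. -/
noncomputable def reducedRow {V : Type*} {ι : Type*} {α : ι → Type*} (G : SimpleGraph V)
    (C : ∀ i : ι, V → α i) (i : ℕ) : Set (Set V) :=
  reducedAux G C (numRows G C) (numRows G C - i)

section GameStructure

variable {V : Type*} {ι : Type*} {α : ι → Type*} {G : SimpleGraph V} {C : ∀ i : ι, V → α i}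

theorem closedNbhd_mono {S T : Set V} (h : T ⊆ S) : closedNbhd G T ⊆ closedNbhd G S := by
  rintro v (hv | ⟨s, hs, hsv⟩)
  · exact Or.inl (h hv)
  · exact Or.inr ⟨s, h hs, hsv⟩

theorem appearsBy_succ {i : ℕ} {S : Set V} (h : appearsBy G C i S) :
    appearsBy G C (i + 1) S := by
  cases i with
  | zero => exact h.elim
  | succ i => exact Or.inl h

theorem appearsBy_mono {S : Set V} : Monotone fun i => appearsBy G C i S :=
  monotone_nat_of_le_succ fun _ => appearsBy_succ

theorem appearsBy.nonempty {i : ℕ} {S : Set V} (h : appearsBy G C i S) : S.Nonempty := by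
  induction i with
  | zero => exact h.elim
  | succ i ih =>
    cases i with
    | zero =>
      obtain ⟨v, rfl⟩ := h
      exact Set.singleton_nonempty v
    | succ i => exact h.elim ih And.left

theorem appearsBy.subset {i : ℕ} {S T : Set V} (h : appearsBy G C i S) (hTS : T ⊆ S)
    (hT : T.Nonempty) : appearsBy G C i T := by
  induction i generalizing S T with
  | zero => exact h.elim
  | succ i ih =>
    cases i with
    | zero =>
      obtain ⟨v, rfl⟩ := h
      exact ⟨v, hT.subset_singleton_iff.mp hTS⟩
    | succ i =>
      rcases h with h | ⟨-, j, hj⟩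
      · exact Or.inl (ih h hTS hT)
      · refine Or.inr ⟨hT, j, fun v hv => ?_⟩
        exact ih (hj v (closedNbhd_mono hTS hv))
          (fun u hu => ⟨closedNbhd_mono hTS hu.1, hu.2⟩) ⟨v, hv, rfl⟩

theorem inRow.index_unique {i k : ℕ} {S : Set V} (hi : inRow G C i S) (hk : inRow G C k S) :
    i = k := by
  rcases lt_trichotomy i k with h | h | h
  · exact (hk.2 (appearsBy_mono (Nat.le_sub_one_of_lt h) hi.1)).elim
  · exact h
  · exact (hi.2 (appearsBy_mono (Nat.le_sub_one_of_lt h) hk.1)).elim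

theorem finite_setOf_exists_inRow [Finite V] : {i | ∃ S : Set V, inRow G C i S}.Finite := by
  choose f hf using fun i : {i | ∃ S : Set V, inRow G C i S} => i.2
  have hinj : Function.Injective f := fun i k h =>
    Subtype.ext ((hf i).index_unique (h ▸ hf k))
  exact Set.finite_coe_iff.mp (Finite.of_injective f hinj)

theorem exists_inRow_numRows [Finite V] (h : 0 < numRows G C) :
    ∃ S : Set V, inRow G C (numRows G C) S := by
  refine Nat.sSup_mem (s := {i | ∃ S : Set V, inRow G C i S}) ?_
    finite_setOf_exists_inRow.bddAbove
  by_contra hne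
  rw [Set.not_nonempty_iff_eq_empty] at hne
  simp [numRows, hne] at h

/-- Every set in row `k` contains an inclusion-minimal set of row `k`. -/
theorem inRow.exists_minimal_subset [Finite V] {k : ℕ} {K : Set V} (hK : inRow G C k K) :
    ∃ T ⊆ K, inRow G C k T ∧
      ∀ U : Set V, U ⊂ T → U.Nonempty → appearsBy G C (k - 1) U := by
  obtain ⟨T, hTK, hT⟩ := exists_minimal_le_of_wellFoundedLT
    (fun X : Set V => X.Nonempty ∧ ¬ appearsBy G C (k - 1) X) K ⟨hK.1.nonempty, hK.2⟩
  refine ⟨T, hTK, ⟨hK.1.subset hTK hT.prop.1, hT.prop.2⟩, fun U hU hne => ?_⟩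
  by_contra hUk
  exact hU.2 (hT.le_of_le ⟨hne, hUk⟩ hU.1)

/-- A set in row `i + 1` has a color class, in some adjoined coloring, lying in row `i`. -/
theorem inRow.exists_class {i : ℕ} (hi : 1 ≤ i) {P : Set V} (hP : inRow G C (i + 1) P) :
    ∃ j, adjoinedAt G C (i + 1) P j ∧ ∃ v, inRow G C i {u ∈ closedNbhd G P | C j u = C j v} := by
  obtain ⟨k, rfl⟩ := Nat.exists_eq_add_of_le' hi
  obtain ⟨h | ⟨⟨p, hp⟩, j, hj⟩, hn⟩ := hP
  · exact (hn h).elim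
  refine ⟨j, hj, ?_⟩
  by_contra! hc
  have hlow : ∀ v ∈ closedNbhd G P,
      appearsBy G C k {u ∈ closedNbhd G P | C j u = C j v} := fun v hv => by
    by_contra hv'
    exact hc v ⟨hj v hv, hv'⟩
  cases k with
  | zero => exact hlow p (Or.inl hp)
  | succ k => exact hn (Or.inr ⟨⟨p, hp⟩, j, hlow⟩)

theorem inRow_of_mem_reducedAux {R d : ℕ} {S : Set V} (h : S ∈ reducedAux G C R d) :
    inRow G C (R - d) S := by
  cases d <;> exact h.1

theorem reducedAux_nonempty [Finite V] {R d : ℕ} (hR : ∃ S : Set V, inRow G C R S)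
    (hd : d < R) : (reducedAux G C R d).Nonempty := by
  induction d with
  | zero =>
    obtain ⟨S, hS⟩ := hR
    obtain ⟨T, -, hT⟩ := hS.exists_minimal_subset
    exact ⟨T, hT⟩
  | succ d ih =>
    obtain ⟨P, hP⟩ := ih (by omega)
    have hrow := inRow_of_mem_reducedAux hP
    rw [show R - d = R - (d + 1) + 1 by omega] at hrow
    obtain ⟨j, hj, v, hv⟩ := hrow.exists_class (by omega)
    obtain ⟨T, hTv, hT, hmin⟩ := hv.exists_minimal_subset
    exact ⟨T, hT, hmin, P, hP, hrow, hT, j, hj,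
      fun x hx y hy => (hTv hx).2.trans (hTv hy).2.symm⟩

end GameStructure

/-- For every finite graph `G` and every finite family of colorings `C₁, …, Cₘ` of
`V(G)`, every row of the reduced game structure of `G` with respect to `C₁, …, Cₘ` is
nonempty; in particular, the reduced game structure has the same number of rows as the
game structure. -/
theorem stmt_9 {V : Type*} [Fintype V] {m : ℕ} {α : Fin m → Type*}
    (G : SimpleGraph V) (C : ∀ i : Fin m, V → α i) :
    ∀ i : ℕ, 1 ≤ i → i ≤ numRows G C → (reducedRow G C i).Nonempty := by
  intro i hi hiR
  exact reducedAux_nonempty (exists_inRow_numRows (by omega)) (by omega)
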